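/- arXiv:2206.02138 — 2 statements merged into one kernel-verified Lean document; each statement's English description precedes it below -/
import Mathlib

section
/- Let α ∈ (0,1), B > 0, and let p : [0,∞) → [0,∞) be a probability density with p(y) = y^{-1-α} for y ≥ B. Let f : [0,∞) → ℝ be a bounded continuous function with f(0) = 0 and f(y) → 0 as y → ∞, and suppose there is a constant L ≥ 0 such that |f(y)| ≤ L y for all y ∈ [0, Bh], where h > 0. Then |h^{-α} ∫₀^∞ f(hy) p(y) dy − ∫₀^∞ f(y) y^{-1-α} dy| ≤ C_B L h^{1-α}, where C_B = B^{1-α}/(1-α) + ∫₀^B y p(y) dy. -/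
open MeasureTheory Set Filter

/-- Let `α ∈ (0,1)`, `B > 0`, and let `p` be a probability density on
`[0,∞)` with `p y = y^(-1-α)` for `y ≥ B`. Let `f` be a bounded continuous function with
`f 0 = 0`, `f y → 0` as `y → ∞`, and `|f y| ≤ L y` on `[0, B*h]` where `h > 0`. Then
`|h^(-α) ∫₀^∞ f (h*y) p y dy − ∫₀^∞ f y y^(-1-α) dy| ≤ C_B L h^(1-α)`,
with `C_B = B^(1-α)/(1-α) + ∫₀^B y p y dy`. -/
theorem ctrw_scaling_rate
    (α B : ℝ) (hα : α ∈ Set.Ioo (0:ℝ) 1) (hB : 0 < B)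
    (p : ℝ → ℝ)
    (hp_nonneg : ∀ y, 0 ≤ y → 0 ≤ p y)
    (hp_meas : Measurable p)
    (hp_prob : ∫ y in Set.Ioi (0:ℝ), p y = 1)
    (hp_tail : ∀ y, B ≤ y → p y = y ^ (-1 - α))
    (h : ℝ) (hh : 0 < h) (L : ℝ) (hL : 0 ≤ L)
    (f : ℝ → ℝ) (hf_cont : Continuous f)
    (hf_bdd : ∃ C, ∀ y, |f y| ≤ C)
    (hf0 : f 0 = 0)
    (hf_inf : Tendsto f atTop (nhds 0))
    (hf_lip : ∀ y ∈ Set.Icc (0:ℝ) (B * h), |f y| ≤ L * y) :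
    |h ^ (-α) * (∫ y in Set.Ioi (0:ℝ), f (h * y) * p y)
        - ∫ y in Set.Ioi (0:ℝ), f y * y ^ (-1 - α)|
      ≤ (B ^ (1 - α) / (1 - α) + ∫ y in Set.Ioc (0:ℝ) B, y * p y) * L * h ^ (1 - α) := by
  obtain ⟨hα0, hα1⟩ := hα
  obtain ⟨C, hC⟩ := hf_bdd
  have hp_int : IntegrableOn p (Ioi 0) := by
    by_contra hn
    rw [integral_undef hn] at hp_prob
    norm_num at hp_prob
  have hg_cont : Continuous (fun y => f (h * y)) := by fun_prop
  have hw_meas : Measurable (fun y : ℝ => y ^ (-1 - α)) := by fun_prop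
  -- rescaling
  have hresc : ∫ y in Ioi (0:ℝ), f y * y ^ (-1 - α)
      = h ^ (-α) * ∫ y in Ioi (0:ℝ), f (h * y) * y ^ (-1 - α) := by
    have h1 := integral_comp_mul_left_Ioi (fun y => f y * y ^ (-1 - α)) 0 hh
    rw [mul_zero, smul_eq_mul] at h1
    have h2 : ∫ y in Ioi (0:ℝ), f (h * y) * (h * y) ^ (-1 - α)
        = h ^ (-1 - α) * ∫ y in Ioi (0:ℝ), f (h * y) * y ^ (-1 - α) := by
      rw [← integral_const_mul]
      refine setIntegral_congr_fun measurableSet_Ioi fun y hy => ?_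
      rw [Real.mul_rpow hh.le (le_of_lt hy)]
      ring
    rw [h2] at h1
    have h3 : h ^ (-α) = h * h ^ (-1 - α) := by
      rw [show -α = 1 + (-1 - α) by ring, Real.rpow_add hh, Real.rpow_one]
    rw [h3, mul_assoc, h1, ← mul_assoc, mul_inv_cancel₀ hh.ne', one_mul]
  have hbnd : ∀ y ∈ Ioc (0:ℝ) B, |f (h * y)| ≤ L * h * y := by
    intro y hy
    have := hf_lip (h * y) ⟨by have := hy.1; positivity, by nlinarith [hy.2]⟩
    linarith
  have hgp : IntegrableOn (fun y => f (h * y) * p y) (Ioi 0) :=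
    Integrable.bdd_mul (c := C) hp_int hg_cont.aestronglyMeasurable
      (Eventually.of_forall fun y => hC _)
  have hpow : IntegrableOn (fun y : ℝ => y ^ (-α)) (Ioc 0 B) :=
    (intervalIntegrable_iff_integrableOn_Ioc_of_le hB.le).1
      (intervalIntegral.intervalIntegrable_rpow' (by linarith))
  have hpow_val : ∫ y in Ioc (0:ℝ) B, y ^ (-α) = B ^ (1 - α) / (1 - α) := by
    rw [← intervalIntegral.integral_of_le hB.le, integral_rpow (Or.inl (by linarith)),
      Real.zero_rpow (by linarith)]
    ring_nf
  have hptw : ∀ y ∈ Ioc (0:ℝ) B, ‖f (h * y) * y ^ (-1 - α)‖ ≤ L * h * y ^ (-α) := by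
    intro y hy
    have hy0 := hy.1
    rw [norm_mul, Real.norm_eq_abs, Real.norm_of_nonneg (by positivity)]
    have h3 : y ^ (-α) = y * y ^ (-1 - α) := by
      rw [show -α = 1 + (-1 - α) by ring, Real.rpow_add hy0, Real.rpow_one]
    rw [h3, ← mul_assoc]
    exact mul_le_mul_of_nonneg_right (hbnd y hy) (by positivity)
  have hgw1 : IntegrableOn (fun y => f (h * y) * y ^ (-1 - α)) (Ioc 0 B) := by
    refine Integrable.mono' (hpow.const_mul (L * h))
      (hg_cont.measurable.mul hw_meas).aestronglyMeasurable ?_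
    exact (ae_restrict_iff' measurableSet_Ioc).2 (Eventually.of_forall hptw)
  have hEq : ∀ y ∈ Ioi B, f (h * y) * p y = f (h * y) * y ^ (-1 - α) := by
    intro y hy
    rw [hp_tail y (le_of_lt hy)]
  have hun : Ioc 0 B ∪ Ioi B = Ioi (0:ℝ) := Ioc_union_Ioi_eq_Ioi hB.le
  have hgp1 := hgp.mono_set (hun ▸ subset_union_left : Ioc 0 B ⊆ Ioi (0:ℝ))
  have hgp2 := hgp.mono_set (hun ▸ subset_union_right : Ioi B ⊆ Ioi (0:ℝ))
  have hgw2 : IntegrableOn (fun y => f (h * y) * y ^ (-1 - α)) (Ioi B) :=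
    hgp2.congr_fun hEq measurableSet_Ioi
  have hdisj : Disjoint (Ioc 0 B) (Ioi B) := by
    rw [Set.disjoint_left]
    intro y hy hy2
    exact absurd hy.2 (not_le.2 hy2)
  rw [hresc, ← mul_sub, ← hun, setIntegral_union hdisj measurableSet_Ioi hgp1 hgp2,
    setIntegral_union hdisj measurableSet_Ioi hgw1 hgw2,
    setIntegral_congr_fun measurableSet_Ioi hEq, add_sub_add_right_eq_sub, abs_mul,
    abs_of_nonneg (by positivity : 0 ≤ h ^ (-α))]
  have hpB := hp_int.mono_set (hun ▸ subset_union_left : Ioc 0 B ⊆ Ioi (0:ℝ))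
  have hyp : IntegrableOn (fun y => y * p y) (Ioc 0 B) := by
    refine Integrable.bdd_mul (c := B) hpB measurable_id.aestronglyMeasurable ?_
    refine (ae_restrict_iff' measurableSet_Ioc).2 (Eventually.of_forall fun y hy => ?_)
    simpa [abs_of_pos hy.1] using hy.2
  have hb1 : |∫ y in Ioc 0 B, f (h * y) * p y| ≤ L * h * ∫ y in Ioc (0:ℝ) B, y * p y := by
    rw [← integral_const_mul, ← Real.norm_eq_abs]
    refine norm_integral_le_of_norm_le (hyp.const_mul (L * h)) ?_
    refine (ae_restrict_iff' measurableSet_Ioc).2 (Eventually.of_forall fun y hy => ?_)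
    have hpy := hp_nonneg y hy.1.le
    rw [norm_mul, Real.norm_eq_abs, Real.norm_of_nonneg hpy, ← mul_assoc]
    exact mul_le_mul_of_nonneg_right (hbnd y hy) hpy
  have hb2 : |∫ y in Ioc 0 B, f (h * y) * y ^ (-1 - α)| ≤ L * h * (B ^ (1 - α) / (1 - α)) := by
    rw [← hpow_val, ← integral_const_mul, ← Real.norm_eq_abs]
    exact norm_integral_le_of_norm_le (hpow.const_mul (L * h))
      ((ae_restrict_iff' measurableSet_Ioc).2 (Eventually.of_forall hptw))
  have h3 : h ^ (1 - α) = h * h ^ (-α) := by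
    rw [show 1 - α = 1 + (-α) by ring, Real.rpow_add hh, Real.rpow_one]
  rw [h3]
  refine (mul_le_mul_of_nonneg_left ((abs_sub _ _).trans (add_le_add hb1 hb2))
    (by positivity)).trans (le_of_eq ?_)
  ring
end

section
/- Let α ∈ (0,1), B > 0, and let p : [0,∞) → [0,∞) be a probability density with p(y) = y^{-1-α} for y ≥ B. Fix τ > 0 and set h = τ^{1/α} (so that τ = h^α). Let x ∈ ℝ and let f : ℝ → ℝ be a bounded continuous function such that |f(x + y) − f(x)| ≤ L y for all y ∈ [0, B τ^{1/α}]. Then |τ^{-1} ∫₀^∞ (f(x + τ^{1/α} y) − f(x)) p(y) dy − ∫₀^∞ (f(x + y) − f(x)) y^{-1-α} dy| ≤ C_B L τ^{(1/α) − 1}, where C_B = B^{1-α}/(1-α) + ∫₀^B y p(y) dy. The same bound holds with x + τ^{1/α} y and x + y replaced by x − τ^{1/α} y and x − y, under the hypothesis |f(x − y) − f(x)| ≤ L y for y ∈ [0, B τ^{1/α}]. -/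
open MeasureTheory Set

theorem ctrw_core
    (α B : ℝ) (hα : α ∈ Set.Ioo (0:ℝ) 1) (hB : 0 < B)
    (p : ℝ → ℝ)
    (hp_nonneg : ∀ y, 0 ≤ y → 0 ≤ p y)
    (hp_meas : Measurable p)
    (hp_prob : ∫ y in Set.Ioi (0:ℝ), p y = 1)
    (hp_tail : ∀ y, B ≤ y → p y = y ^ (-1 - α))
    (K : ℝ) (G : ℝ → ℝ) (hG : Continuous G)
    (hbdd : ∃ C, ∀ y, |G y| ≤ C)
    (hK : ∀ y ∈ Set.Icc (0:ℝ) B, |G y| ≤ K * y) :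
    |(∫ y in Set.Ioi (0:ℝ), G y * p y) - ∫ y in Set.Ioi (0:ℝ), G y * y ^ (-1 - α)|
      ≤ (B ^ (1 - α) / (1 - α) + ∫ y in Set.Ioc (0:ℝ) B, y * p y) * K := by
  obtain ⟨hα0, hα1⟩ := hα
  obtain ⟨C, hC⟩ := hbdd
  have hpi : IntegrableOn p (Ioi 0) := by
    by_contra h
    have := integral_undef h
    rw [this] at hp_prob
    norm_num at hp_prob
  have hGp : IntegrableOn (fun y => G y * p y) (Ioi 0) :=
    hpi.bdd_mul (c := C) hG.aestronglyMeasurable (Filter.Eventually.of_forall hC)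
  have hun : Ioc (0:ℝ) B ∪ Ioi B = Ioi 0 := Ioc_union_Ioi_eq_Ioi hB.le
  have hGp1 := hGp.mono_set (Ioc_subset_Ioi_self : Ioc (0:ℝ) B ⊆ Ioi 0)
  have hGp2 := hGp.mono_set (Ioi_subset_Ioi hB.le)
  have hE : EqOn (fun y => G y * p y) (fun y => G y * y ^ (-1 - α)) (Ioi B) := by
    intro y hy
    simp only [hp_tail y (le_of_lt hy)]
  have hq2 : IntegrableOn (fun y => G y * y ^ (-1 - α)) (Ioi B) :=
    hGp2.congr_fun hE measurableSet_Ioi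
  have hpow : IntegrableOn (fun y : ℝ => y ^ (-α)) (Ioc 0 B) :=
    (intervalIntegrable_iff_integrableOn_Ioc_of_le hB.le).1
      (intervalIntegral.intervalIntegrable_rpow' (by linarith))
  have hbq : ∀ y ∈ Ioc (0:ℝ) B, ‖G y * y ^ (-1 - α)‖ ≤ K * y ^ (-α) := by
    intro y hy
    have h1 := hK y ⟨hy.1.le, hy.2⟩
    have h2 : 0 ≤ y ^ (-1 - α) := Real.rpow_nonneg hy.1.le _
    rw [Real.norm_eq_abs, abs_mul, abs_of_nonneg h2]
    have h3 : y ^ (-α) = y * y ^ (-1 - α) := by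
      rw [← Real.rpow_one_add' hy.1.le (by linarith)]
      congr 1; ring
    rw [h3, ← mul_assoc]
    exact mul_le_mul_of_nonneg_right h1 h2
  have hbp : ∀ y ∈ Ioc (0:ℝ) B, ‖G y * p y‖ ≤ K * (y * p y) := by
    intro y hy
    have h2 := hp_nonneg y hy.1.le
    rw [Real.norm_eq_abs, abs_mul, abs_of_nonneg h2, ← mul_assoc]
    exact mul_le_mul_of_nonneg_right (hK y ⟨hy.1.le, hy.2⟩) h2
  have hq1 : IntegrableOn (fun y => G y * y ^ (-1 - α)) (Ioc 0 B) := by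
    refine Integrable.mono' (hpow.const_mul K) ?_ ?_
    · exact (hG.measurable.mul (by fun_prop)).aestronglyMeasurable
    · exact (ae_restrict_iff' measurableSet_Ioc).2 (Filter.Eventually.of_forall hbq)
  have hyp : IntegrableOn (fun y => y * p y) (Ioc 0 B) := by
    refine Integrable.mono' ((hpi.mono_set (Ioc_subset_Ioi_self : Ioc (0:ℝ) B ⊆ Ioi 0)).const_mul B) ?_ ?_
    · exact (measurable_id.mul hp_meas).aestronglyMeasurable
    · refine (ae_restrict_iff' measurableSet_Ioc).2 (Filter.Eventually.of_forall fun y hy => ?_)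
      have h2 := hp_nonneg y hy.1.le
      rw [Real.norm_eq_abs, abs_mul, abs_of_nonneg h2, abs_of_pos hy.1]
      exact mul_le_mul_of_nonneg_right hy.2 h2
  have e1 := setIntegral_union (Ioc_disjoint_Ioi le_rfl) measurableSet_Ioi hGp1 hGp2
  have e2 := setIntegral_union (Ioc_disjoint_Ioi le_rfl) measurableSet_Ioi hq1 hq2
  rw [hun] at e1 e2
  rw [e1, e2, setIntegral_congr_fun measurableSet_Ioi hE, add_sub_add_right_eq_sub]
  have b1 : ‖∫ y in Ioc (0:ℝ) B, G y * p y‖ ≤ ∫ y in Ioc (0:ℝ) B, K * (y * p y) :=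
    norm_integral_le_of_norm_le (hyp.const_mul K)
      ((ae_restrict_iff' measurableSet_Ioc).2 (Filter.Eventually.of_forall hbp))
  have b2 : ‖∫ y in Ioc (0:ℝ) B, G y * y ^ (-1 - α)‖ ≤ ∫ y in Ioc (0:ℝ) B, K * y ^ (-α) :=
    norm_integral_le_of_norm_le (hpow.const_mul K)
      ((ae_restrict_iff' measurableSet_Ioc).2 (Filter.Eventually.of_forall hbq))
  have e3 : ∫ y in Ioc (0:ℝ) B, y ^ (-α) = B ^ (1 - α) / (1 - α) := by
    rw [← intervalIntegral.integral_of_le hB.le, integral_rpow (Or.inl (by linarith)),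
      Real.zero_rpow (by linarith), sub_zero, neg_add_eq_sub]
  rw [integral_const_mul] at b1 b2
  rw [e3] at b2
  rw [← Real.norm_eq_abs]
  refine (norm_sub_le _ _).trans ?_
  linarith

theorem ctrw_scaled
    (α B : ℝ) (hα : α ∈ Set.Ioo (0:ℝ) 1) (hB : 0 < B)
    (p : ℝ → ℝ)
    (hp_nonneg : ∀ y, 0 ≤ y → 0 ≤ p y)
    (hp_meas : Measurable p)
    (hp_prob : ∫ y in Set.Ioi (0:ℝ), p y = 1)
    (hp_tail : ∀ y, B ≤ y → p y = y ^ (-1 - α))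
    (τ : ℝ) (hτ : 0 < τ) (L : ℝ) (g : ℝ → ℝ) (hg : Continuous g)
    (hbdd : ∃ C, ∀ y, |g y| ≤ C)
    (hL : ∀ y ∈ Set.Icc (0:ℝ) (B * τ ^ (1/α)), |g y| ≤ L * y) :
    |τ⁻¹ * (∫ y in Set.Ioi (0:ℝ), g (τ ^ (1/α) * y) * p y)
        - ∫ y in Set.Ioi (0:ℝ), g y * y ^ (-1 - α)|
      ≤ (B ^ (1 - α) / (1 - α) + ∫ y in Set.Ioc (0:ℝ) B, y * p y) * L * τ ^ (1/α - 1) := by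
  have hτh : (τ ^ (1/α)) ^ α = τ := by
    rw [← Real.rpow_mul hτ.le, one_div_mul_cancel hα.1.ne', Real.rpow_one]
  have hτ1 : τ ^ (1/α - 1) = τ⁻¹ * τ ^ (1/α) := by
    rw [Real.rpow_sub_one hτ.ne']; field_simp
  have hh : 0 < τ ^ (1/α) := Real.rpow_pos_of_pos hτ _
  rw [hτ1]
  generalize τ ^ (1/α) = h at *
  have key := ctrw_core α B hα hB p hp_nonneg hp_meas hp_prob hp_tail (L * h)
    (fun y => g (h * y)) (by fun_prop) (hbdd.imp fun C hC y => hC _) (by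
      intro y hy
      have := hL (h * y) ⟨mul_nonneg hh.le hy.1, by nlinarith [hy.2]⟩
      simpa [mul_assoc] using this)
  have hs := integral_comp_mul_left_Ioi (fun y => g y * y ^ (-1 - α)) 0 hh
  have hs2 : ∫ y in Ioi (0:ℝ), g (h * y) * (h * y) ^ (-1 - α)
      = h⁻¹ * τ⁻¹ * ∫ y in Ioi (0:ℝ), g (h * y) * y ^ (-1 - α) := by
    rw [← integral_const_mul]
    refine setIntegral_congr_fun measurableSet_Ioi fun y hy => ?_
    rw [Real.mul_rpow hh.le (le_of_lt hy), Real.rpow_sub hh, Real.rpow_neg_one, hτh]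
    field_simp
  rw [hs2, mul_zero, smul_eq_mul, mul_assoc] at hs
  rw [← mul_left_cancel₀ (inv_ne_zero hh.ne') hs, ← mul_sub, abs_mul,
    abs_of_pos (inv_pos.2 hτ)]
  calc _ ≤ τ⁻¹ * _ := mul_le_mul_of_nonneg_left key (inv_pos.2 hτ).le
    _ = _ := by ring

/-- Let `α ∈ (0,1)`, `B > 0`, and let `p` be a probability density on
`[0,∞)` with `p y = y^(-1-α)` for `y ≥ B`. Fix `τ > 0` (so `h = τ^(1/α)`). Let `f` be
bounded continuous. If `|f(x + y) − f(x)| ≤ L y` for `y ∈ [0, B τ^(1/α)]` then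
`|τ⁻¹ ∫₀^∞ (f(x + τ^(1/α) y) − f(x)) p y dy − ∫₀^∞ (f(x + y) − f(x)) y^(-1-α) dy|
  ≤ C_B L τ^(1/α − 1)`, and the analogous bound holds for `x − τ^(1/α) y`, `x − y` under
the hypothesis `|f(x − y) − f(x)| ≤ L y` for `y ∈ [0, B τ^(1/α)]`. -/
theorem ctrw_generator_rate
    (α B : ℝ) (hα : α ∈ Set.Ioo (0:ℝ) 1) (hB : 0 < B)
    (p : ℝ → ℝ)
    (hp_nonneg : ∀ y, 0 ≤ y → 0 ≤ p y)
    (hp_meas : Measurable p)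
    (hp_prob : ∫ y in Set.Ioi (0:ℝ), p y = 1)
    (hp_tail : ∀ y, B ≤ y → p y = y ^ (-1 - α))
    (τ : ℝ) (hτ : 0 < τ) (L : ℝ) (hL : 0 ≤ L)
    (x : ℝ) (f : ℝ → ℝ) (hf_cont : Continuous f)
    (hf_bdd : ∃ C, ∀ y, |f y| ≤ C) :
    ((∀ y ∈ Set.Icc (0:ℝ) (B * τ ^ (1/α)), |f (x + y) - f x| ≤ L * y) →
      |τ⁻¹ * (∫ y in Set.Ioi (0:ℝ), (f (x + τ ^ (1/α) * y) - f x) * p y)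
          - ∫ y in Set.Ioi (0:ℝ), (f (x + y) - f x) * y ^ (-1 - α)|
        ≤ (B ^ (1 - α) / (1 - α) + ∫ y in Set.Ioc (0:ℝ) B, y * p y) * L * τ ^ (1/α - 1))
    ∧
    ((∀ y ∈ Set.Icc (0:ℝ) (B * τ ^ (1/α)), |f (x - y) - f x| ≤ L * y) →
      |τ⁻¹ * (∫ y in Set.Ioi (0:ℝ), (f (x - τ ^ (1/α) * y) - f x) * p y)
          - ∫ y in Set.Ioi (0:ℝ), (f (x - y) - f x) * y ^ (-1 - α)|
        ≤ (B ^ (1 - α) / (1 - α) + ∫ y in Set.Ioc (0:ℝ) B, y * p y) * L * τ ^ (1/α - 1)) := by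
  obtain ⟨C, hC⟩ := hf_bdd
  have hb : ∀ u : ℝ → ℝ, ∃ D, ∀ y, |f (u y) - f x| ≤ D := fun u =>
    ⟨C + C, fun y => (abs_sub _ _).trans (add_le_add (hC _) (hC _))⟩
  constructor
  · intro h
    exact ctrw_scaled α B hα hB p hp_nonneg hp_meas hp_prob hp_tail τ hτ L
      (fun y => f (x + y) - f x) (by fun_prop) (hb _) h
  · intro h
    exact ctrw_scaled α B hα hB p hp_nonneg hp_meas hp_prob hp_tail τ hτ L
      (fun y => f (x - y) - f x) (by fun_prop) (hb _) h
end
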